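/- Let μ, λ ⊨ n and let A be a row-standard μ-tableau of type λ. Then the Coxeter length of the permutation 1_A is l(1_A) = ∑_{g<h} ∑_{i<j} A^g_j · A^h_i, where the sums run over pairs of rows g < h of μ and pairs of values i < j. -/

import Mathlib

open scoped Classical

noncomputable section

namespace FayersSemistd

/-- The value at `q` of the Gaussian (quantum) binomial coefficient polynomial
`[a choose b]`, defined via the `q`-Pascal recurrence. -/
def qBinom {F : Type*} [Field F] (q : F) : ℕ → ℕ → F
  | _, 0 => 1
  | 0, _+1 => 0
  | a+1, b+1 => qBinom q a b + q ^ (b+1) * qBinom q a (b+1)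

/-- `∏_i [A_i + B_i choose A_i]_q`, where `A_i`, `B_i` are multiplicities in the
multisets `A` and `B`. -/
def qBinomProd {F : Type*} [Field F] (q : F) (A B : Multiset ℕ) : F :=
  ∏ i ∈ (A + B).toFinset, qBinom q ((A + B).count i) (A.count i)

/-- `∑_{i<j} A_j * B_i` : the number of pairs `(x,y)` with `x ∈ A`, `y ∈ B`, `y < x`,
counted with multiplicity. -/
def invPairs (A B : Multiset ℕ) : ℕ :=
  ((A.product B).filter (fun p => p.2 < p.1)).card

/-- The Coxeter length of a permutation of `{0,…,n-1}`: its number of inversions. -/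
def permLength {n : ℕ} (w : Equiv.Perm (Fin n)) : ℕ :=
  (Finset.univ.filter (fun p : Fin n × Fin n => p.1 < p.2 ∧ w p.2 < w p.1)).card

/-- `λ_0 + ⋯ + λ_{r-1}`. -/
def cumSum (lam : ℕ → ℕ) (r : ℕ) : ℕ := ∑ i ∈ Finset.range r, lam i

/-- The (0-indexed) row of the diagram of `λ` containing the (0-indexed) position `p`,
when positions are listed row by row. -/
def rowOf (lam : ℕ → ℕ) (p : ℕ) : ℕ := sInf {r | p < cumSum lam (r+1)}

/-- `λ` is a composition of `n`: finitely many nonzero parts, summing to `n`. -/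
def IsComposition (n : ℕ) (lam : ℕ → ℕ) : Prop :=
  ∃ N, (∀ r, N ≤ r → lam r = 0) ∧ cumSum lam N = n

/-- `μ` is a partition of `n`. -/
def IsPartition (n : ℕ) (mu : ℕ → ℕ) : Prop := IsComposition n mu ∧ Antitone mu

/-- The conjugate partition (0-indexed): `conjP μ i = #{r | μ r > i}`. -/
def conjP (mu : ℕ → ℕ) (i : ℕ) : ℕ := sInf {r | mu r ≤ i}

/-- The standard Young subgroup `W_λ` of `S_n` (as a set): the permutations preserving
each consecutive block of sizes `λ_0, λ_1, …`. -/
def youngW {n : ℕ} (lam : ℕ → ℕ) : Set (Equiv.Perm (Fin n)) :=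
  {w | ∀ p : Fin n, rowOf lam ((w p : Fin n) : ℕ) = rowOf lam (p : ℕ)}

/-- The adjacent transposition `(i, i+1)` (0-indexed) in `S_n`. -/
def adjT {n : ℕ} (i : ℕ) (h : i + 1 < n) : Equiv.Perm (Fin n) :=
  Equiv.swap ⟨i, Nat.lt_of_succ_lt h⟩ ⟨i+1, h⟩

/-- `T : S_n → H` is the standard basis of an Iwahori–Hecke algebra of `S_n` over `F`
with parameter `q`.  Permutations act on the right, so the product `w·s` of the paper
is `s * w` in Mathlib's convention; the multiplication rule
`T_w T_s = T_{ws}` (length increasing) resp. `T_w T_s = q T_{ws} + (q-1) T_w`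
(length decreasing) determines the algebra structure on the basis. -/
structure IsHeckeBasis {F : Type*} [Field F] {H : Type*} [Ring H] [Algebra F H] {n : ℕ}
    (q : F) (T : Equiv.Perm (Fin n) → H) : Prop where
  li : LinearIndependent F T
  total : Submodule.span F (Set.range T) = ⊤
  one : T 1 = 1
  mul_adj_asc : ∀ (w : Equiv.Perm (Fin n)) (i : ℕ) (h : i + 1 < n),
    permLength w < permLength (adjT i h * w) →
    T w * T (adjT i h) = T (adjT i h * w)
  mul_adj_desc : ∀ (w : Equiv.Perm (Fin n)) (i : ℕ) (h : i + 1 < n),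
    permLength (adjT i h * w) < permLength w →
    T w * T (adjT i h) = q • T (adjT i h * w) + (q - 1) • T w

variable {F : Type*} [Field F] {H : Type*} [Ring H] [Algebra F H] {n : ℕ}

/-- `x_λ = ∑_{w ∈ W_λ} T_w`. -/
def xElt (T : Equiv.Perm (Fin n) → H) (lam : ℕ → ℕ) : H :=
  ∑ w ∈ Finset.univ.filter (· ∈ youngW lam), T w

/-- `y_λ = ∑_{w ∈ W_λ} (-q)^{-l(w)} T_w`. -/
def yElt (q : F) (T : Equiv.Perm (Fin n) → H) (lam : ℕ → ℕ) : H :=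
  ∑ w ∈ Finset.univ.filter (· ∈ youngW lam), ((-q)⁻¹) ^ permLength w • T w

/-- The double coset `W_λ d W_μ` (paper convention: maps act on the right, so the
paper product `u·d·v` is `v * d * u` in Mathlib's convention). -/
def doubleCoset {n : ℕ} (lam mu : ℕ → ℕ) (d : Equiv.Perm (Fin n)) :
    Set (Equiv.Perm (Fin n)) :=
  {w | ∃ u ∈ youngW (n := n) lam, ∃ v ∈ youngW (n := n) mu, w = v * d * u}

/-- `∑_{w ∈ W_λ 1_A W_μ} T_w`, the image `x_μ φ_A` of `x_μ` under the tableau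
homomorphism `φ_A : M^μ → M^λ`, where `d = 1_A`. -/
def XPhi (T : Equiv.Perm (Fin n) → H) (lam mu : ℕ → ℕ) (d : Equiv.Perm (Fin n)) : H :=
  ∑ w ∈ Finset.univ.filter (· ∈ doubleCoset lam mu d), T w

/-- A row-standard tableau is recorded by the multisets of entries of its rows; it has
shape `μ` when row `r` has `μ_r` entries. -/
def RowsOfShape (mu : ℕ → ℕ) (A : ℕ → Multiset ℕ) : Prop := ∀ r, (A r).card = mu r

/-- The tableau with rows `A 0, A 1, …` has type `λ` when the entry `v` occurs `λ_v`
times in total (entries and types are 0-indexed). -/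
def HasType (A : ℕ → Multiset ℕ) (lam : ℕ → ℕ) : Prop :=
  ∀ v, (∑ᶠ r, (A r).count v) = lam v

/-- The entry in row `r`, column `c` (0-indexed) of the row-standard tableau with row
multisets `A`. -/
def entryAt (A : ℕ → Multiset ℕ) (r c : ℕ) : ℕ := ((A r).sort (· ≤ ·)).getD c 0

/-- `d = 1_A` for the row-standard `μ`-tableau `A` of type `λ`: the tableau `t^λ d`
(whose entry at position `p` is `d p`) is row-standard (first clause), and the entry
`d p` lies in row `r` of `t^λ d` exactly when the position occupied by `d p` in `t^μ`
is occupied by `r` in `A` (second clause). -/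
def Is1A {n : ℕ} (mu lam : ℕ → ℕ) (A : ℕ → Multiset ℕ) (d : Equiv.Perm (Fin n)) : Prop :=
  (∀ p p' : Fin n, rowOf lam (p : ℕ) = rowOf lam (p' : ℕ) → p < p' → d p < d p') ∧
  (∀ p : Fin n,
    entryAt A (rowOf mu ((d p : Fin n) : ℕ))
      (((d p : Fin n) : ℕ) - cumSum mu (rowOf mu ((d p : Fin n) : ℕ)))
      = rowOf lam (p : ℕ))

/-- A row-standard tableau is semistandard if its columns are strictly increasing. -/
def Semistandard (mu : ℕ → ℕ) (A : ℕ → Multiset ℕ) : Prop :=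
  ∀ r c, c < mu (r+1) → entryAt A r c < entryAt A (r+1) c

/-- The (0-indexed) column of the position `p` in the diagram of `μ`. -/
def colIdx (mu : ℕ → ℕ) (p : ℕ) : ℕ := p - cumSum mu (rowOf mu p)

/-- `w = w_μ`, i.e. `t^μ w = t_μ`: the image of position `p` is the number of positions
coming strictly before `p` in the column-reading order of the diagram of `μ`. -/
def IsWmu {n : ℕ} (mu : ℕ → ℕ) (w : Equiv.Perm (Fin n)) : Prop :=
  ∀ p : Fin n, ((w p : Fin n) : ℕ) = (Finset.univ.filter (fun p' : Fin n =>
    colIdx mu (p' : ℕ) < colIdx mu (p : ℕ) ∨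
      (colIdx mu (p' : ℕ) = colIdx mu (p : ℕ) ∧ rowOf mu (p' : ℕ) < rowOf mu (p : ℕ)))).card

def comp1 (a : ℕ) : ℕ → ℕ := fun r => if r = 0 then a else 0
def comp2 (a b : ℕ) : ℕ → ℕ := fun r => if r = 0 then a else if r = 1 then b else 0
def comp3 (a b c : ℕ) : ℕ → ℕ :=
  fun r => if r = 0 then a else if r = 1 then b else if r = 2 then c else 0
def comp4 (a b c d : ℕ) : ℕ → ℕ :=
  fun r => if r = 0 then a else if r = 1 then b else if r = 2 then c else if r = 3 then d else 0
def rows1 (a : Multiset ℕ) : ℕ → Multiset ℕ := fun r => if r = 0 then a else 0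
def rows2 (a b : Multiset ℕ) : ℕ → Multiset ℕ :=
  fun r => if r = 0 then a else if r = 1 then b else 0
def rows3 (a b c : Multiset ℕ) : ℕ → Multiset ℕ :=
  fun r => if r = 0 then a else if r = 1 then b else if r = 2 then c else 0
def rows4 (a b c d : Multiset ℕ) : ℕ → Multiset ℕ :=
  fun r => if r = 0 then a else if r = 1 then b else if r = 2 then c else if r = 3 then d else 0

end FayersSemistd
namespace FayersSemistd

theorem lt_cumSum_rowOf_succ {n : ℕ} {nu : ℕ → ℕ} (hnu : IsComposition n nu) {p : ℕ}
    (hp : p < n) : p < cumSum nu (rowOf nu p + 1) := by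
  obtain ⟨N, -, hN⟩ := hnu
  have hne : {r | p < cumSum nu (r + 1)}.Nonempty := by
    refine ⟨N, ?_⟩
    have : cumSum nu (N + 1) = cumSum nu N + nu N := Finset.sum_range_succ _ _
    simp only [Set.mem_ofPred_eq]
    omega
  exact Nat.sInf_mem hne

theorem cumSum_rowOf_le (nu : ℕ → ℕ) (p : ℕ) : cumSum nu (rowOf nu p) ≤ p := by
  by_contra! h
  rcases hr : rowOf nu p with _ | k
  · simp [hr, cumSum] at h
  · have : rowOf nu p ≤ k := Nat.sInf_le (show p < cumSum nu (k + 1) by rwa [← hr])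
    omega

theorem cumSum_mono (nu : ℕ → ℕ) : Monotone (cumSum nu) := fun _ _ h =>
  Finset.sum_le_sum_of_subset (Finset.range_mono h)

theorem rowOf_eq_iff {n : ℕ} {nu : ℕ → ℕ} (hnu : IsComposition n nu) {p g : ℕ} (hp : p < n) :
    rowOf nu p = g ↔ cumSum nu g ≤ p ∧ p < cumSum nu (g + 1) := by
  constructor
  · rintro rfl
    exact ⟨cumSum_rowOf_le nu p, lt_cumSum_rowOf_succ hnu hp⟩
  · rintro ⟨h1, h2⟩
    refine le_antisymm (Nat.sInf_le h2) ?_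
    by_contra! h
    have := cumSum_mono nu (Nat.succ_le_of_lt h)
    have := lt_cumSum_rowOf_succ hnu hp
    simp only [Nat.succ_eq_add_one] at *
    omega

theorem rowOf_mono {n : ℕ} {nu : ℕ → ℕ} (hnu : IsComposition n nu) {p q : ℕ} (hpq : p ≤ q)
    (hq : q < n) : rowOf nu p ≤ rowOf nu q :=
  Nat.sInf_le (hpq.trans_lt (lt_cumSum_rowOf_succ hnu hq))

theorem cumSum_le_of_isComposition {n : ℕ} {nu : ℕ → ℕ} (hnu : IsComposition n nu) (r : ℕ) :
    cumSum nu r ≤ n := by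
  obtain ⟨N, h0, rfl⟩ := hnu
  rcases le_total r N with h | h
  · exact cumSum_mono nu h
  · refine (Finset.sum_subset (Finset.range_mono h) fun i _ hi => h0 i ?_).ge
    simpa using hi

/-- The entry of the row-standard `mu`-tableau with rows `A` at the position `m`, where positions
are listed row by row. -/
def entryAtPos (mu : ℕ → ℕ) (A : ℕ → Multiset ℕ) (m : ℕ) : ℕ :=
  entryAt A (rowOf mu m) (m - cumSum mu (rowOf mu m))

theorem entryAt_mono (A : ℕ → Multiset ℕ) (r : ℕ) {c c' : ℕ} (h : c ≤ c')
    (hc : c' < (A r).card) : entryAt A r c ≤ entryAt A r c' := by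
  have hlen : ((A r).sort (· ≤ ·)).length = (A r).card := Multiset.length_sort ..
  rw [entryAt, entryAt, List.getD_eq_getElem _ _ (by omega), List.getD_eq_getElem _ _ (by omega)]
  exact (Multiset.pairwise_sort (A r) (· ≤ ·)).rel_get_of_le
    (a := ⟨c, by omega⟩) (b := ⟨c', by omega⟩) h

theorem map_entryAt_range (A : ℕ → Multiset ℕ) (r : ℕ) :
    (Multiset.range (A r).card).map (entryAt A r) = A r := by
  have hlen : ((A r).sort (· ≤ ·)).length = (A r).card := Multiset.length_sort ..
  conv_rhs => rw [← Multiset.sort_eq (A r) (· ≤ ·)]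
  rw [← Multiset.coe_range, Multiset.map_coe]
  congr 1
  refine List.ext_getElem (by simp) fun i h1 h2 => ?_
  simp [entryAt, List.getElem?_eq_getElem h2]

theorem entryAtPos_le_of_rowOf_eq {n : ℕ} {mu : ℕ → ℕ} (hmu : IsComposition n mu)
    {A : ℕ → Multiset ℕ} (hshape : RowsOfShape mu A) {a b : ℕ} (hab : a ≤ b) (hb : b < n)
    (hrow : rowOf mu a = rowOf mu b) : entryAtPos mu A a ≤ entryAtPos mu A b := by
  rw [entryAtPos, entryAtPos, hrow]
  refine entryAt_mono A _ (by omega) ?_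
  have h1 := lt_cumSum_rowOf_succ hmu hb
  have h2 : cumSum mu (rowOf mu b + 1) = cumSum mu (rowOf mu b) + mu (rowOf mu b) :=
    Finset.sum_range_succ _ _
  have h3 := cumSum_rowOf_le mu b
  rw [hshape]
  omega

theorem map_entryAtPos_filter_rowOf {n : ℕ} {mu : ℕ → ℕ} (hmu : IsComposition n mu)
    {A : ℕ → Multiset ℕ} (hshape : RowsOfShape mu A) (g : ℕ) :
    ((Finset.range n).filter (rowOf mu · = g)).val.map (entryAtPos mu A) = A g := by
  have hsucc : cumSum mu (g + 1) = cumSum mu g + mu g := Finset.sum_range_succ _ _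
  have hle := cumSum_le_of_isComposition hmu (g + 1)
  have hset : (Finset.range n).filter (rowOf mu · = g)
      = (Finset.range (mu g)).map (addLeftEmbedding (cumSum mu g)) := by
    ext m
    simp only [Finset.mem_filter, Finset.mem_range, Finset.mem_map, addLeftEmbedding_apply]
    constructor
    · rintro ⟨hm, hr⟩
      have := (rowOf_eq_iff hmu hm).1 hr
      exact ⟨m - cumSum mu g, by omega, by omega⟩
    · rintro ⟨c, hc, rfl⟩
      exact ⟨by omega, (rowOf_eq_iff hmu (by omega)).2 ⟨by omega, by omega⟩⟩
  rw [hset, Finset.map_val, Multiset.map_map]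
  conv_rhs => rw [← map_entryAt_range A g, hshape g]
  refine Multiset.map_congr rfl fun c hc => ?_
  have hc : c < mu g := by simpa using hc
  have hr : rowOf mu (cumSum mu g + c) = g :=
    (rowOf_eq_iff hmu (by omega)).2 ⟨by omega, by omega⟩
  simp [entryAtPos, hr]

theorem zero_invPairs (B : Multiset ℕ) : invPairs 0 B = 0 := by
  simp [invPairs, Multiset.product]

theorem invPairs_zero (B : Multiset ℕ) : invPairs B 0 = 0 := by
  simp [invPairs, Multiset.product]

theorem invPairs_map_val (v : ℕ → ℕ) (s t : Finset ℕ) :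
    invPairs (s.val.map v) (t.val.map v) = ((s ×ˢ t).filter fun p => v p.2 < v p.1).card := by
  have hprod : (s.val.map v).product (t.val.map v)
      = (s ×ˢ t).val.map fun p => (v p.1, v p.2) := by
    change (s.val.map v) ×ˢ (t.val.map v) = (s.val ×ˢ t.val).map _
    simp [SProd.sprod, Multiset.product, Multiset.map_bind, Multiset.bind_map]
  rw [invPairs, hprod, Multiset.filter_map, Multiset.card_map]
  rfl

/-- The length of a permutation `d` with `t^λ d` row-standard is the number of pairs of positions
whose entries are out of order. -/
theorem permLength_eq_card_entryAtPos {n : ℕ} {mu lam : ℕ → ℕ} (hlam : IsComposition n lam)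
    {A : ℕ → Multiset ℕ} {d : Equiv.Perm (Fin n)} (hd : Is1A mu lam A d) :
    permLength d = ((Finset.range n ×ˢ Finset.range n).filter fun p =>
      p.1 < p.2 ∧ entryAtPos mu A p.2 < entryAtPos mu A p.1).card := by
  obtain ⟨hinc, hent⟩ := hd
  have hent : ∀ p : Fin n, entryAtPos mu A (d p) = rowOf lam p := hent
  refine Finset.card_bij (fun p _ => ((d p.2 : ℕ), (d p.1 : ℕ))) ?_ ?_ ?_
  · rintro ⟨p, q⟩ h
    simp only [Finset.mem_filter, Finset.mem_univ, true_and, Finset.mem_product,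
      Finset.mem_range] at h ⊢
    refine ⟨⟨(d q).2, (d p).2⟩, h.2, ?_⟩
    rw [hent, hent]
    refine lt_of_le_of_ne (rowOf_mono hlam h.1.le q.2) fun he => ?_
    exact lt_asymm h.2 (hinc p q he h.1)
  · rintro ⟨p, q⟩ - ⟨p', q'⟩ - h
    simp only [Prod.mk.injEq, Fin.val_inj, d.injective.eq_iff] at h
    simp [h]
  · rintro ⟨a, b⟩ h
    simp only [Finset.mem_filter, Finset.mem_product, Finset.mem_range] at h
    obtain ⟨⟨ha, hb⟩, hab, hv⟩ := h
    obtain ⟨q, hq⟩ := d.surjective ⟨a, ha⟩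
    obtain ⟨p, hp⟩ := d.surjective ⟨b, hb⟩
    have hqa : (d q : ℕ) = a := by rw [hq]
    have hpb : (d p : ℕ) = b := by rw [hp]
    subst hqa hpb
    rw [hent, hent] at hv
    refine ⟨(p, q), ?_, rfl⟩
    simp only [Finset.mem_filter, Finset.mem_univ, true_and]
    refine ⟨?_, hab⟩
    by_contra! hqp
    exact absurd (rowOf_mono hlam (show (q : ℕ) ≤ p from hqp) p.2) (by omega)

theorem finsum_finsum_eq_sum_range {M : Type*} [AddCommMonoid M] (f : ℕ → ℕ → M) (N : ℕ)
    (h1 : ∀ g h, N ≤ g → f g h = 0) (h2 : ∀ g h, N ≤ h → f g h = 0) :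
    ∑ᶠ g, ∑ᶠ h, f g h = ∑ x ∈ Finset.range N ×ˢ Finset.range N, f x.1 x.2 := by
  have aux : ∀ F : ℕ → M, (∀ k, N ≤ k → F k = 0) → ∑ᶠ k, F k = ∑ k ∈ Finset.range N, F k := by
    refine fun F hF => finsum_eq_sum_of_support_subset F fun k hk => ?_
    simp only [Finset.coe_range, Set.mem_Iio]
    by_contra! hNk
    exact hk (hF k hNk)
  rw [Finset.sum_product, aux]
  · exact Finset.sum_congr rfl fun g _ => aux _ (h2 g)
  · intro g hg
    simp [h1 g _ hg]

/-- for a row-standard `μ`-tableau `A` of type `λ` (`μ, λ ⊨ n`),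
the Coxeter length of `1_A` is `l(1_A) = ∑_{g<h} ∑_{i<j} A^g_j A^h_i`; the inner sum
`∑_{i<j} A^g_j A^h_i` is the number of pairs `(x, y)` with `x` an entry of row `g`,
`y` an entry of row `h` and `y < x`, i.e. `invPairs (A g) (A h)`. -/
theorem length_of_oneA
    {n : ℕ} (mu lam : ℕ → ℕ) (hmu : IsComposition n mu) (hlam : IsComposition n lam)
    (A : ℕ → Multiset ℕ) (hshape : RowsOfShape mu A) (htype : HasType A lam)
    (d : Equiv.Perm (Fin n)) (hd : Is1A mu lam A d) :
    permLength d = ∑ᶠ g, ∑ᶠ h, if g < h then invPairs (A g) (A h) else 0 := by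
  obtain ⟨N, h0, hN⟩ := hmu
  have hA : ∀ r, N ≤ r → A r = 0 := fun r hr => by
    rw [← Multiset.card_eq_zero, hshape, h0 r hr]
  have hmu : IsComposition n mu := ⟨N, h0, hN⟩
  rw [finsum_finsum_eq_sum_range _ N (fun g h hg => by simp [hA g hg, zero_invPairs])
    (fun g h hh => by simp [hA h hh, invPairs_zero]), permLength_eq_card_entryAtPos hlam hd]
  have hrow : ∀ p, p < n → rowOf mu p < N := fun p hp => by
    by_contra! h
    have := cumSum_mono mu h
    have := cumSum_rowOf_le mu p
    omega
  rw [Finset.card_eq_sum_card_fiberwise (f := fun p => (rowOf mu p.1, rowOf mu p.2))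
    (t := Finset.range N ×ˢ Finset.range N)]
  · refine Finset.sum_congr rfl ?_
    rintro ⟨g, h⟩ -
    dsimp only
    split_ifs with hgh
    · conv_rhs => rw [← map_entryAtPos_filter_rowOf hmu hshape g,
        ← map_entryAtPos_filter_rowOf hmu hshape h, invPairs_map_val]
      congr 1
      ext ⟨a, b⟩
      simp only [Finset.mem_filter, Finset.mem_product, Finset.mem_range, Prod.mk.injEq]
      constructor
      · tauto
      · rintro ⟨⟨⟨ha, rfl⟩, hb, rfl⟩, hv⟩
        refine ⟨⟨⟨ha, hb⟩, ?_, hv⟩, rfl, rfl⟩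
        by_contra! hba
        exact absurd (rowOf_mono hmu hba ha) (by omega)
    · rw [Finset.card_eq_zero, Finset.filter_eq_empty_iff]
      rintro ⟨a, b⟩ hab heq
      simp only [Finset.mem_filter, Finset.mem_product, Finset.mem_range, Prod.mk.injEq] at hab heq
      obtain ⟨⟨ha, hb⟩, hlt, hv⟩ := hab
      obtain ⟨rfl, rfl⟩ := heq
      have := rowOf_mono hmu hlt.le hb
      have := entryAtPos_le_of_rowOf_eq hmu hshape hlt.le hb (by omega)
      omega
  · rintro ⟨a, b⟩ hab
    simp only [Finset.coe_filter, Finset.mem_product, Finset.mem_range, Set.mem_ofPred_eq] at hab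
    simp [hrow a hab.1.1, hrow b hab.1.2]

end FayersSemistd
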